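/- Let u, v ∈ ℝ⁴ be linearly independent and let u', v' ∈ ℝ⁴ be linearly independent, and suppose the cross-simplicity constraint *(u∧v) · (u'∧v') = 0 holds. Then the two 2-planes intersect nontrivially: span{u, v} ∩ span{u', v'} ≠ {0}. -/

import Mathlib

open scoped BigOperators
open Matrix

noncomputable section

/-- The Levi-Civita symbol on four indices, with `eps 0 1 2 3 = 1`. -/
def eps (i j k l : Fin 4) : ℝ :=
  ∑ σ : Equiv.Perm (Fin 4),
    if σ 0 = i ∧ σ 1 = j ∧ σ 2 = k ∧ σ 3 = l then ((Equiv.Perm.sign σ : ℤ) : ℝ) else 0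

/-- The wedge product of two vectors in `ℝ⁴`, as an antisymmetric 4×4 matrix (bivector). -/
def wedge (u v : Fin 4 → ℝ) : Matrix (Fin 4) (Fin 4) ℝ :=
  Matrix.of fun i j => u i * v j - u j * v i

/-- The dot product of two bivectors: full index contraction. -/
def bdot (B C : Matrix (Fin 4) (Fin 4) ℝ) : ℝ := ∑ i, ∑ j, B i j * C i j

/-- The Hodge dual of a bivector. -/
def hodge (B : Matrix (Fin 4) (Fin 4) ℝ) : Matrix (Fin 4) (Fin 4) ℝ :=
  Matrix.of fun i j => (1 / 2 : ℝ) * ∑ k, ∑ l, eps i j k l * B k l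

/-- Contraction with the Levi-Civita symbol is a signed sum over permutations. -/
lemma sum_eps_mul (f : Fin 4 → Fin 4 → Fin 4 → Fin 4 → ℝ) :
    ∑ i, ∑ j, ∑ k, ∑ l, eps i j k l * f i j k l =
      ∑ σ : Equiv.Perm (Fin 4),
        ((Equiv.Perm.sign σ : ℤ) : ℝ) * f (σ 0) (σ 1) (σ 2) (σ 3) := by
  have hσ (σ : Equiv.Perm (Fin 4)) :
      ((Equiv.Perm.sign σ : ℤ) : ℝ) * f (σ 0) (σ 1) (σ 2) (σ 3) =
        ∑ i, ∑ j, ∑ k, ∑ l, (if σ 0 = i ∧ σ 1 = j ∧ σ 2 = k ∧ σ 3 = l then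
          ((Equiv.Perm.sign σ : ℤ) : ℝ) else 0) * f i j k l := by
    simp [ite_and, ite_mul]
  simp_rw [hσ, eps, Finset.sum_mul]
  symm
  rw [Finset.sum_comm]
  refine Finset.sum_congr rfl fun i _ => ?_
  rw [Finset.sum_comm]
  refine Finset.sum_congr rfl fun j _ => ?_
  rw [Finset.sum_comm]
  refine Finset.sum_congr rfl fun k _ => ?_
  rw [Finset.sum_comm]

/-- The determinant of four vectors in `ℝ⁴` as a signed sum over permutations. -/
lemma det_of_vecs (a b c d : Fin 4 → ℝ) :
    (Matrix.of ![a, b, c, d]).det = ∑ σ : Equiv.Perm (Fin 4),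
      ((Equiv.Perm.sign σ : ℤ) : ℝ) * (a (σ 0) * b (σ 1) * c (σ 2) * d (σ 3)) := by
  rw [← Matrix.det_transpose, Matrix.det_apply']
  simp [Fin.prod_univ_four]

/-- The pairing `*(u ∧ v) · (a ∧ b)` is twice the determinant of `a, b, u, v`. -/
lemma bdot_hodge_wedge (u v a b : Fin 4 → ℝ) :
    bdot (hodge (wedge u v)) (wedge a b) = 2 * (Matrix.of ![a, b, u, v]).det := by
  have hab (a b c d : Fin 4 → ℝ) :
      (Matrix.of ![b, a, c, d]).det = -(Matrix.of ![a, b, c, d]).det := by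
    refine Eq.trans (congrArg Matrix.detRowAlternating ?_)
      (Matrix.detRowAlternating.map_swap ![a, b, c, d] (show (0 : Fin 4) ≠ 1 by decide))
    ext i j
    fin_cases i <;> rfl
  have hcd (a b c d : Fin 4 → ℝ) :
      (Matrix.of ![a, b, d, c]).det = -(Matrix.of ![a, b, c, d]).det := by
    refine Eq.trans (congrArg Matrix.detRowAlternating ?_)
      (Matrix.detRowAlternating.map_swap ![a, b, c, d] (show (2 : Fin 4) ≠ 3 by decide))
    ext i j
    fin_cases i <;> rfl
  have key : bdot (hodge (wedge u v)) (wedge a b) =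
      (1 / 2 : ℝ) * ((Matrix.of ![a, b, u, v]).det - (Matrix.of ![b, a, u, v]).det -
        (Matrix.of ![a, b, v, u]).det + (Matrix.of ![b, a, v, u]).det) := by
    calc bdot (hodge (wedge u v)) (wedge a b)
        = (1 / 2 : ℝ) * ∑ i, ∑ j, ∑ k, ∑ l,
            eps i j k l * (wedge u v k l * wedge a b i j) := by
          simp only [bdot, hodge, Matrix.of_apply, Finset.mul_sum, Finset.sum_mul, mul_assoc]
      _ = _ := by
          rw [sum_eps_mul]
          simp only [det_of_vecs, ← Finset.sum_sub_distrib, ← Finset.sum_add_distrib]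
          congr 1
          refine Finset.sum_congr rfl fun σ _ => ?_
          simp only [wedge, Matrix.of_apply]
          ring
  rw [key, hab a b u v, hab a b v u, hcd a b u v]
  ring

/-- The cross-simplicity constraint between two simple bivectors forces their
2-planes to intersect nontrivially. -/
theorem cross_simplicity_planes_intersect
    (u v u' v' : Fin 4 → ℝ)
    (h : LinearIndependent ℝ ![u, v]) (h' : LinearIndependent ℝ ![u', v'])
    (hsimp : bdot (hodge (wedge u v)) (wedge u' v') = 0) :
    ∃ x : Fin 4 → ℝ, x ≠ 0
      ∧ x ∈ Submodule.span ℝ ({u, v} : Set (Fin 4 → ℝ))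
      ∧ x ∈ Submodule.span ℝ ({u', v'} : Set (Fin 4 → ℝ)) := by
  have hdet : (Matrix.of ![u', v', u, v]).det = 0 := by
    rw [bdot_hodge_wedge] at hsimp
    linarith
  obtain ⟨w, hw, hw0⟩ := Matrix.exists_vecMul_eq_zero_iff.mpr hdet
  have hsum : w 0 • u' + w 1 • v' + w 2 • u + w 3 • v = 0 := by
    ext j
    simpa [Matrix.vecMul, dotProduct, Fin.sum_univ_four] using congrFun hw0 j
  have hx : w 2 • u + w 3 • v = (-w 0) • u' + (-w 1) • v' := by
    rw [← sub_eq_zero, ← hsum]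
    module
  refine ⟨w 2 • u + w 3 • v, fun h0 => hw ?_, Submodule.mem_span_pair.mpr ⟨_, _, rfl⟩,
    Submodule.mem_span_pair.mpr ⟨_, _, hx.symm⟩⟩
  obtain ⟨h2, h3⟩ := LinearIndependent.pair_iff.mp h _ _ h0
  obtain ⟨h0', h1'⟩ := LinearIndependent.pair_iff.mp h' _ _ (hx.symm.trans h0)
  ext i
  fin_cases i
  · exact neg_eq_zero.mp h0'
  · exact neg_eq_zero.mp h1'
  · exact h2
  · exact h3
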